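/- arXiv:2103.00307 — 2 statements merged into one kernel-verified Lean document; each statement's English description precedes it below -/
import Mathlib

section
/- For every integer m > 1, the elliptic curve E_m over ℚ defined by y² = x³ - x + m⁶ has trivial torsion subgroup: the only point of E_m(ℚ) of finite order is the identity. -/
/-- The elliptic curve `E_m : y² = x³ - x + m⁶` over `ℚ`. -/
def Em (m : ℤ) : WeierstrassCurve ℚ := ⟨0, 0, 0, -1, (m : ℚ) ^ 6⟩

open WeierstrassCurve.Affine in
/-- The equation of a point. -/
lemma em_eq {m : ℤ} {x y : ℚ} (h : (Em m).toAffine.Nonsingular x y) :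
    y ^ 2 = x ^ 3 - x + (m : ℚ) ^ 6 := by
  have h1 := ((Em m).toAffine.equation_iff x y).mp h.1
  simp [Em] at h1
  linarith

lemma em_double {m : ℤ} {x y : ℚ} (h : (Em m).toAffine.Nonsingular x y) (hy : y ≠ 0)
    (l : ℚ) (hl : l = (3 * x ^ 2 - 1) / (2 * y)) :
    ∃ h', (WeierstrassCurve.Affine.Point.some x y h : (Em m).toAffine.Point) + .some x y h =
      .some (l ^ 2 - 2 * x) (-(l * (l ^ 2 - 3 * x) + y)) h' := by
  have hne : y ≠ (Em m).toAffine.negY x y := by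
    simp only [WeierstrassCurve.Affine.negY, Em]
    intro h1
    apply hy
    linarith
  have hs : (Em m).toAffine.slope x x y y = l := by
    rw [WeierstrassCurve.Affine.slope_of_Y_ne rfl hne, hl]
    simp only [WeierstrassCurve.Affine.negY, Em]
    congr 1 <;> ring
  have hX : (Em m).toAffine.addX x x ((Em m).toAffine.slope x x y y) = l ^ 2 - 2 * x := by
    rw [hs]; simp only [WeierstrassCurve.Affine.addX, Em]; ring
  have hY : (Em m).toAffine.addY x x y ((Em m).toAffine.slope x x y y)
      = -(l * (l ^ 2 - 3 * x) + y) := by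
    rw [hs]
    simp only [WeierstrassCurve.Affine.addX, WeierstrassCurve.Affine.addY,
      WeierstrassCurve.Affine.negAddY, WeierstrassCurve.Affine.negY, Em]; ring
  have hadd := WeierstrassCurve.Affine.Point.add_self_of_Y_ne (h₁ := h) hne
  rw [← hX, ← hY]
  exact ⟨_, hadd⟩

lemma em_add {m : ℤ} {x y x' y' : ℚ} (h : (Em m).toAffine.Nonsingular x y)
    (h' : (Em m).toAffine.Nonsingular x' y') (hx : x ≠ x')
    (l : ℚ) (hl : l = (y - y') / (x - x')) :
    ∃ y'' h'', (WeierstrassCurve.Affine.Point.some x y h : (Em m).toAffine.Point) +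
      .some x' y' h' = .some (l ^ 2 - x - x') y'' h'' := by
  have hs : (Em m).toAffine.slope x x' y y' = l := by
    rw [WeierstrassCurve.Affine.slope_of_X_ne hx, hl]
  have hX : (Em m).toAffine.addX x x' ((Em m).toAffine.slope x x' y y') = l ^ 2 - x - x' := by
    rw [hs]; simp only [WeierstrassCurve.Affine.addX, Em]; ring
  have hadd := WeierstrassCurve.Affine.Point.add_of_X_ne (h₁ := h) (h₂ := h') hx
  rw [← hX]
  exact ⟨_, _, hadd⟩

/-! ### No 2-torsion -/

lemma no_root {m : ℤ} (hm : 1 < m) (x : ℚ) : x ^ 3 - x + (m : ℚ) ^ 6 ≠ 0 := by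
  intro h
  -- clear denominators
  have hd : (x.den : ℚ) ≠ 0 := by exact_mod_cast x.den_nz
  have hq : (x.num : ℚ) ^ 3 - x.num * x.den ^ 2 + m ^ 6 * x.den ^ 3 = 0 := by
    have hx : x = x.num / x.den := (Rat.num_div_den x).symm
    have : ((x.num : ℚ) / x.den) ^ 3 - x.num / x.den + (m : ℚ) ^ 6 = 0 := by rw [← hx]; exact h
    field_simp at this
    linear_combination this
  have hz : x.num ^ 3 - x.num * (x.den : ℤ) ^ 2 + m ^ 6 * (x.den : ℤ) ^ 3 = 0 := by
    exact_mod_cast hq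
  have hco : IsCoprime x.num (x.den : ℤ) := by
    rw [Int.isCoprime_iff_gcd_eq_one]
    have := x.reduced
    simpa [Nat.Coprime, Int.gcd] using this
  have hdvd : (x.den : ℤ) ∣ x.num ^ 3 :=
    ⟨x.num * x.den - m ^ 6 * x.den ^ 2, by linear_combination hz⟩
  have hu : IsUnit (x.den : ℤ) := hco.pow_left.symm.isUnit_of_dvd' dvd_rfl hdvd
  have h1 : (x.den : ℤ) = 1 := by
    rcases Int.isUnit_iff.mp hu with h1 | h1 <;> omega
  rw [h1] at hz
  generalize x.num = p at hz
  have hm0 : (0 : ℤ) < m ^ 6 := by positivity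
  have hprod : (p ^ 2 - 1) * (-p) = (m ^ 3) ^ 2 := by linear_combination -hz
  have hcop : IsCoprime (p ^ 2 - 1) (-p) := ⟨-1, -p, by ring⟩
  obtain ⟨c, hc | hc⟩ := Int.sq_of_isCoprime hcop hprod
  · have hf : (p - c) * (p + c) = 1 := by linear_combination hc
    have hc0 : c = 0 := by
      rcases Int.mul_eq_one_iff_eq_one_or_neg_one.mp hf with ⟨h1, h2⟩ | ⟨h1, h2⟩ <;> omega
    subst hc0
    rw [hc] at hprod
    nlinarith
  · have hp : p ^ 2 ≤ 1 := by nlinarith [sq_nonneg c]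
    have hp1 : p ≤ 1 := by nlinarith
    have hp2 : -1 ≤ p := by nlinarith
    interval_cases p <;> nlinarith

/-! ### No 3-torsion -/

lemma no_three (b : ℤ) (x : ℚ) : 3 * x ^ 4 - 6 * x ^ 2 + 12 * b * x - 1 ≠ 0 := by
  intro h
  have hd : (x.den : ℚ) ≠ 0 := by exact_mod_cast x.den_nz
  have hq : 3 * (x.num : ℚ) ^ 4 - 6 * x.num ^ 2 * x.den ^ 2 + 12 * b * x.num * x.den ^ 3
      - x.den ^ 4 = 0 := by
    have hx : x = x.num / x.den := (Rat.num_div_den x).symm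
    have : 3 * ((x.num : ℚ) / x.den) ^ 4 - 6 * (x.num / x.den) ^ 2
      + 12 * b * (x.num / x.den) - 1 = 0 := by rw [← hx]; exact h
    field_simp at this
    linear_combination this
  have hz : 3 * x.num ^ 4 - 6 * x.num ^ 2 * (x.den : ℤ) ^ 2 + 12 * b * x.num * (x.den : ℤ) ^ 3
      - (x.den : ℤ) ^ 4 = 0 := by
    exact_mod_cast hq
  have hco : IsCoprime x.num (x.den : ℤ) := by
    rw [Int.isCoprime_iff_gcd_eq_one]
    have := x.reduced
    simpa [Nat.Coprime, Int.gcd] using this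
  generalize x.num = p at *
  generalize (x.den : ℤ) = q at *
  have h3 : (3 : ℤ) ∣ q := by
    apply Int.prime_three.dvd_of_dvd_pow (n := 4)
    exact ⟨p ^ 4 - 2 * p ^ 2 * q ^ 2 + 4 * b * p * q ^ 3, by linear_combination -hz⟩
  have h3' : (3 : ℤ) ∣ p := by
    obtain ⟨r, rfl⟩ := h3
    apply Int.prime_three.dvd_of_dvd_pow (n := 4)
    exact ⟨6 * p ^ 2 * r ^ 2 - 36 * b * p * r ^ 3 + 9 * r ^ 4, by linarith⟩
  have := hco.isUnit_of_dvd' h3' h3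
  exact Int.prime_three.not_isUnit this

/-! ### 2-adic norm -/

local notation "N" => padicNorm 2

lemma N_two : N 2 = 1 / 2 := by
  have := padicNorm.padicNorm_p_of_prime (p := 2)
  norm_num at this ⊢
  exact this

lemma N_three : N 3 = 1 := by
  have := (padicNorm.int_eq_one_iff (p := 2) 3).mpr (by norm_num)
  exact_mod_cast this

lemma N_pow (x : ℚ) (n : ℕ) : N (x ^ n) = N x ^ n := by
  induction n with
  | zero => simp
  | succ k ih => rw [pow_succ, padicNorm.mul, ih, pow_succ]

lemma N_add_lt {q r : ℚ} (h : N r < N q) : N (q + r) = N q := by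
  rw [padicNorm.add_eq_max_of_ne h.ne', max_eq_left h.le]

lemma N_add_le {q r t : ℚ} (hq : N q ≤ t) (hr : N r ≤ t) : N (q + r) ≤ t :=
  padicNorm.nonarchimedean.trans (max_le hq hr)

lemma N_sub_le {q r t : ℚ} (hq : N q ≤ t) (hr : N r ≤ t) : N (q - r) ≤ t :=
  padicNorm.sub.trans (max_le hq hr)

lemma N_lt {x : ℚ} (h : N x < 1) : N x ≤ 1 / 2 := by
  by_cases hx : x = 0
  · subst hx; simp
  obtain ⟨z, hz⟩ := padicNorm.values_discrete (p := 2) hx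
  rw [hz] at h ⊢
  have h0 : -z < 0 := by
    by_contra hcon
    push Not at hcon
    have := one_le_zpow₀ (a := ((2 : ℕ) : ℚ)) (by norm_num) hcon
    linarith
  calc ((2 : ℕ) : ℚ) ^ (-z) ≤ ((2 : ℕ) : ℚ) ^ (-1 : ℤ) :=
        zpow_le_zpow_right₀ (by norm_num) (by omega)
    _ = 1 / 2 := by norm_num

/-- The residue field has two elements. -/
lemma N_unit_sub {x y : ℚ} (h : N x = 1) (h' : N y = 1) : N (x - y) ≤ 1 / 2 := by
  have key : ∀ u : ℚ, N u = 1 → N (u - 1) ≤ 1 / 2 := by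
    intro u hu
    have hd : (u.den : ℚ) ≠ 0 := by exact_mod_cast u.den_nz
    have hx : u = u.num / u.den := (Rat.num_div_den u).symm
    have hN : N (u.num : ℚ) = N (u.den : ℚ) := by
      have : (u.num : ℚ) = u * u.den := by field_simp at hx; linarith
      rw [this, padicNorm.mul, hu, one_mul]
    have hden : N ((u.den : ℤ) : ℚ) = 1 := by
      by_contra hcon
      have h1 : N ((u.den : ℤ) : ℚ) < 1 := lt_of_le_of_ne (padicNorm.of_int _) hcon
      have h2 : N (u.num : ℚ) < 1 := by rw [hN]; exact_mod_cast h1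
      rw [padicNorm.int_lt_one_iff] at h1 h2
      have hco : IsCoprime u.num (u.den : ℤ) := by
        rw [Int.isCoprime_iff_gcd_eq_one]
        have := u.reduced
        simpa [Nat.Coprime, Int.gcd] using this
      exact Int.prime_two.not_isUnit (hco.isUnit_of_dvd' h2 h1)
    have hnum : N (u.num : ℚ) = 1 := by rw [hN]; exact_mod_cast hden
    have h2 : N ((u.num - u.den : ℤ) : ℚ) < 1 := by
      rw [padicNorm.int_eq_one_iff] at hden hnum
      rw [padicNorm.int_lt_one_iff]
      push_cast at *
      omega
    apply N_lt
    have he : u - 1 = ((u.num - u.den : ℤ) : ℚ) / ((u.den : ℤ) : ℚ) := by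
      push_cast
      rw [sub_div, ← hx, div_self hd]
    rw [he, padicNorm.div, hden, div_one]
    exact h2
  have : x - y = (x - 1) - (y - 1) := by ring
  rw [this]
  exact N_sub_le (key x h) (key y h')

lemma N_m (m : ℤ) : N ((m : ℚ) ^ 6) ≤ 1 := by
  have := padicNorm.of_int (p := 2) (m ^ 6)
  exact_mod_cast this

/-- Doubling a point outside the 2-integral ones. -/
lemma N_double {m : ℤ} {x y l : ℚ} (he : y ^ 2 = x ^ 3 - x + (m : ℚ) ^ 6) (hx : 1 < N x)
    (hl : l = (3 * x ^ 2 - 1) / (2 * y)) : N (l ^ 2 - 2 * x) = 4 * N x := by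
  have hx0 : 0 < N x := by linarith
  have h1 : N (3 * x ^ 2 - 1) = N x ^ 2 := by
    have : N (3 * x ^ 2) = N x ^ 2 := by rw [padicNorm.mul, N_three, N_pow, one_mul]
    rw [sub_eq_add_neg, N_add_lt, this]
    rw [this, padicNorm.neg, padicNorm.one]
    nlinarith
  have h2 : N y ^ 2 = N x ^ 3 := by
    rw [← N_pow, he, ← N_pow x 3, sub_add, sub_eq_add_neg]
    apply N_add_lt
    rw [padicNorm.neg, N_pow]
    have : N (x - (m : ℚ) ^ 6) ≤ N x := N_sub_le le_rfl ((N_m m).trans hx.le)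
    nlinarith [mul_pos hx0 hx0]
  have h3 : N (l ^ 2) = 4 * N x := by
    rw [hl, N_pow, padicNorm.div, h1, padicNorm.mul, N_two, div_pow, mul_pow, h2]
    field_simp
    norm_num
  rw [sub_eq_add_neg, N_add_lt, h3]
  rw [h3, padicNorm.neg, padicNorm.mul, N_two]
  linarith

/-- Points that are not 2-integral have infinite order. -/
lemma not_fin {m : ℤ} (hm : 1 < m) {x y : ℚ} (h : (Em m).toAffine.Nonsingular x y)
    (hf : IsOfFinAddOrder (WeierstrassCurve.Affine.Point.some x y h : (Em m).toAffine.Point)) :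
    N x ≤ 1 := by
  by_contra hx
  push Not at hx
  set P : (Em m).toAffine.Point := WeierstrassCurve.Affine.Point.some x y h with hP
  have key : ∀ k : ℕ, ∃ x' y' h', (2 ^ k) • P = WeierstrassCurve.Affine.Point.some x' y' h' ∧
      N x' = 4 ^ k * N x := by
    intro k
    induction k with
    | zero => exact ⟨x, y, h, by simp [hP], by simp⟩
    | succ k ih =>
      obtain ⟨x', y', h', h1, h2⟩ := ih
      have he := em_eq h'
      have hy : y' ≠ 0 := by
        rintro rfl
        apply no_root hm x'
        linarith
      obtain ⟨h'', hd⟩ := em_double h' hy _ rfl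
      refine ⟨_, _, h'', ?_, ?_⟩
      · rw [pow_succ, mul_two, add_smul, h1, hd]
      · rw [N_double he _ rfl, h2]
        · ring
        · rw [h2]
          have : (1 : ℚ) ≤ 4 ^ k := one_le_pow₀ (by norm_num)
          nlinarith
  have hfin : (AddSubmonoid.multiples P : Set (Em m).toAffine.Point).Finite :=
    finite_multiples.mpr hf
  have hinj : Function.Injective (fun k : ℕ => (2 ^ k) • P) := by
    intro i j hij
    obtain ⟨x1, y1, h1, e1, n1⟩ := key i
    obtain ⟨x2, y2, h2, e2, n2⟩ := key j
    simp only [e1, e2] at hij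
    injection hij with hxx hyy
    rw [hxx, n2] at n1
    have h4 : (4 : ℚ) ^ j = 4 ^ i := mul_right_cancel₀ (by linarith) n1
    exact (pow_right_injective₀ (by norm_num) (by norm_num) h4).symm
  have hmem : ∀ k : ℕ, (2 ^ k) • P ∈ (AddSubmonoid.multiples P : Set (Em m).toAffine.Point) :=
    fun k => ⟨2 ^ k, rfl⟩
  exact Set.infinite_of_injective_forall_mem hinj hmem hfin

/-- For an affine torsion point, `x`, `y` and the tangent slope are 2-adic units. -/
lemma units {m : ℤ} (hm : 1 < m) {x y l : ℚ} (h : (Em m).toAffine.Nonsingular x y)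
    (hf : IsOfFinAddOrder (WeierstrassCurve.Affine.Point.some x y h : (Em m).toAffine.Point))
    (hl : l = (3 * x ^ 2 - 1) / (2 * y)) : y ≠ 0 ∧ N x = 1 ∧ (N l ≤ 1 → N y = 1) := by
  have he := em_eq h
  have hy : y ≠ 0 := by
    rintro rfl
    apply no_root hm x
    linarith
  obtain ⟨h'', hd⟩ := em_double h hy l hl
  have hf2 := hf.add hf
  rw [hd] at hf2
  have hx := not_fin hm h hf
  have hx2 := not_fin hm h'' hf2
  have hl1 : N l ≤ 1 := by
    have : N (l ^ 2) ≤ 1 := by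
      have e : l ^ 2 = (l ^ 2 - 2 * x) + 2 * x := by ring
      rw [e]
      apply N_add_le hx2
      rw [padicNorm.mul, N_two]; linarith
    rw [N_pow] at this
    exact (sq_le_one_iff₀ (padicNorm.nonneg _)).mp this
  have hy1 : N y ≤ 1 := by
    have : N (y ^ 2) ≤ 1 := by
      rw [he]
      apply N_add_le _ (N_m m)
      apply N_sub_le _ hx
      rw [N_pow]; exact pow_le_one₀ (padicNorm.nonneg _) hx
    rw [N_pow] at this
    exact (sq_le_one_iff₀ (padicNorm.nonneg _)).mp this
  have hmul : N (3 * x ^ 2 - 1) = N l * (1 / 2 * N y) := by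
    rw [← N_two, ← padicNorm.mul, ← padicNorm.mul, hl]
    congr 1
    field_simp
  have hy0 := padicNorm.nonneg (p := 2) y
  have hl0 := padicNorm.nonneg (p := 2) l
  have hx1 : N x = 1 := by
    by_contra hcon
    have hlt := lt_of_le_of_ne hx hcon
    have : N (3 * x ^ 2 - 1) = 1 := by
      have e : 3 * x ^ 2 - 1 = -1 + 3 * x ^ 2 := by ring
      rw [e, N_add_lt, padicNorm.neg, padicNorm.one]
      rw [padicNorm.neg, padicNorm.one, padicNorm.mul, N_three, N_pow, one_mul]
      exact pow_lt_one₀ (padicNorm.nonneg _) hlt (by norm_num)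
    nlinarith
  refine ⟨hy, hx1, fun _ => ?_⟩
  have h4 : N (3 * x ^ 2 - 1) = 1 / 2 := by
    have e : 3 * x ^ 2 - 1 = 2 + 3 * ((x - 1) * (x - (-1))) := by ring
    have a1 := N_unit_sub hx1 padicNorm.one
    have a2 := N_unit_sub (y := -1) hx1 (by rw [padicNorm.neg, padicNorm.one])
    rw [e, N_add_lt, N_two]
    rw [padicNorm.mul, N_three, padicNorm.mul, N_two]
    nlinarith [padicNorm.nonneg (p := 2) (x - 1), padicNorm.nonneg (p := 2) (x - (-1))]
  nlinarith

/-- For every integer `m > 1`, the curve `E_m : y² = x³ - x + m⁶` has trivial torsion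
subgroup: the only rational point of finite order is the identity. -/
theorem Em_torsion_trivial (m : ℤ) (hm : 1 < m) :
    ∀ p : (Em m).toAffine.Point, IsOfFinAddOrder p → p = 0 := by
  rintro (_ | ⟨x, y, h⟩) hf
  · rfl
  exfalso
  have he := em_eq h
  obtain ⟨l, hl⟩ : ∃ l, l = (3 * x ^ 2 - 1) / (2 * y) := ⟨_, rfl⟩
  obtain ⟨hy, hx1, hy1⟩ := units hm h hf hl
  obtain ⟨h2, hd⟩ := em_double h hy l hl
  have hf2 := hf.add hf
  rw [hd] at hf2
  obtain ⟨-, hx2, -⟩ := units hm h2 hf2 rfl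
  have unit_of : ∀ u t : ℚ, N (u ^ 2 - t) = 1 → N t ≤ 1 / 2 → N u = 1 := by
    intro u t h1 h3
    have e : u ^ 2 = (u ^ 2 - t) + t := by ring
    have : N (u ^ 2) = 1 := by rw [e, N_add_lt, h1]; linarith
    rw [N_pow] at this
    exact (pow_eq_one_iff_of_nonneg (padicNorm.nonneg _) (by norm_num)).mp this
  have hl1 : N l = 1 := unit_of l (2 * x) hx2 (by rw [padicNorm.mul, N_two, hx1]; norm_num)
  have hy1 := hy1 hl1.le
  have hly : l * (2 * y) = 3 * x ^ 2 - 1 := by rw [hl]; field_simp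
  have hne : x ≠ l ^ 2 - 2 * x := by
    intro hcon
    apply no_three (m ^ 6) x
    have h3 : l ^ 2 = 3 * x := by linarith
    have h4 : (3 * x ^ 2 - 1) ^ 2 = 12 * x * (x ^ 3 - x + (m : ℚ) ^ 6) := by
      rw [← hly, ← he]
      linear_combination 4 * y ^ 2 * h3
    push_cast
    linear_combination -h4
  obtain ⟨k, hk⟩ : ∃ k, k = (y - -(l * (l ^ 2 - 3 * x) + y)) / (x - (l ^ 2 - 2 * x)) := ⟨_, rfl⟩
  obtain ⟨y3, h3, hadd⟩ := em_add h h2 hne k hk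
  have hf3 := hf.add hf2
  rw [hadd] at hf3
  obtain ⟨-, hx3, -⟩ := units hm h3 hf3 rfl
  have hxx : N (x - (l ^ 2 - 2 * x)) ≤ 1 / 2 := N_unit_sub hx1 hx2
  have hk1 : N k = 1 := by
    apply unit_of k (x + (l ^ 2 - 2 * x))
    · rw [← hx3]; congr 1; ring
    · have := N_unit_sub (y := -(l ^ 2 - 2 * x)) hx1 (by rw [padicNorm.neg, hx2])
      rwa [sub_neg_eq_add] at this
  have hkl : N (k - -l) ≤ 1 / 2 := N_unit_sub hk1 (by rw [padicNorm.neg, hl1])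
  have hsub : x - (l ^ 2 - 2 * x) ≠ 0 := sub_ne_zero.mpr hne
  have hfin : 2 * y = (k - -l) * (x - (l ^ 2 - 2 * x)) := by
    have : k * (x - (l ^ 2 - 2 * x)) = y - -(l * (l ^ 2 - 3 * x) + y) := by
      rw [hk, div_mul_cancel₀ _ hsub]
    linear_combination -this
  have hN := congrArg N hfin
  rw [padicNorm.mul, padicNorm.mul, N_two, hy1] at hN
  nlinarith [padicNorm.nonneg (p := 2) (k - -l), padicNorm.nonneg (p := 2) (x - (l ^ 2 - 2 * x))]
end

section
/- For every nonzero integer m, the elliptic curve E'_m over ℚ defined by y² = x³ + x - m⁶ has trivial torsion subgroup: the only point of E'_m(ℚ) of finite order is the identity. -/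
/-- The elliptic curve `E'_m : y² = x³ + x - m⁶` over `ℚ`. -/
def Em' (m : ℤ) : WeierstrassCurve ℚ := ⟨0, 0, 0, 1, -(m : ℚ) ^ 6⟩

open WeierstrassCurve WeierstrassCurve.Affine

theorem Em'_eqn {m : ℤ} {x y : ℚ} (h : (Em' m).toAffine.Nonsingular x y) :
    y ^ 2 = x ^ 3 + x - (m : ℚ) ^ 6 := by
  have h1 := ((Em' m).toAffine.equation_iff x y).1 h.1
  simp only [Em'] at h1
  linarith

/-- There is no rational 2-torsion. -/
theorem Em'_y_ne {m : ℤ} (hm : m ≠ 0) {x y : ℚ} (h : y ^ 2 = x ^ 3 + x - (m : ℚ) ^ 6) :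
    y ≠ 0 := by
  rintro rfl
  have hx : x ^ 3 + x - (m : ℚ) ^ 6 = 0 := by linarith
  have hint : IsLocalization.IsInteger ℤ x := by
    apply isInteger_of_is_root_of_monic
      (p := Polynomial.X ^ 3 + Polynomial.X - Polynomial.C (m ^ 6))
    · monicity!
    · simpa using hx
  obtain ⟨n, rfl⟩ := hint
  simp only [algebraMap_int_eq, eq_intCast] at hx
  have hn : (n ^ 2 + 1) * n = (m ^ 3) ^ 2 := by
    have : n ^ 3 + n - m ^ 6 = 0 := by exact_mod_cast hx
    linarith
  have hc : IsCoprime (n ^ 2 + 1) n := ⟨1, -n, by ring⟩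
  obtain ⟨s, hs⟩ := Int.sq_of_gcd_eq_one (Int.isCoprime_iff_gcd_eq_one.1 hc) hn
  have hs' : n ^ 2 + 1 = s ^ 2 := by
    rcases hs with hs | hs
    · exact hs
    · nlinarith [sq_nonneg n, sq_nonneg s]
  have hn0 : n = 0 := by
    have h1 : |n| < |s| := sq_lt_sq.1 (by linarith)
    have h2 : |n| + 1 ≤ |s| := h1
    have h3 := sq_abs n
    have h4 := sq_abs s
    have h5 := abs_nonneg n
    have : |n| = 0 := by nlinarith
    exact abs_eq_zero.1 this
  subst hn0
  have : m ^ 3 = 0 := by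
    have : (m ^ 3) ^ 2 = 0 := by linarith
    exact pow_eq_zero_iff (two_ne_zero) |>.1 this
  exact hm (pow_eq_zero_iff (three_ne_zero) |>.1 this)

theorem Em'_dbl {m : ℤ} {x y : ℚ} (h : (Em' m).toAffine.Nonsingular x y) (hy : y ≠ 0) :
    ∃ (x2 y2 : ℚ) (h2 : (Em' m).toAffine.Nonsingular x2 y2),
      Point.some x y h + Point.some x y h = Point.some x2 y2 h2 ∧
      x2 = ((3 * x ^ 2 + 1) / (2 * y)) ^ 2 - 2 * x ∧
      y2 = -(y + (3 * x ^ 2 + 1) / (2 * y) * (x2 - x)) := by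
  have hne : y ≠ (Em' m).toAffine.negY x y := by
    simp only [negY, Em']
    intro h0
    apply hy
    linarith
  have hs : (Em' m).toAffine.slope x x y y = (3 * x ^ 2 + 1) / (2 * y) := by
    rw [slope_of_Y_ne rfl hne]
    simp only [negY, Em']
    congr 1 <;> ring
  refine ⟨_, _, _, Point.add_self_of_Y_ne hne, ?_, ?_⟩
  · rw [hs]; simp only [addX, Em']; ring
  · rw [hs]; simp only [addY, negAddY, negY, addX, Em']; ring

theorem Em'_dbl_x {m : ℤ} {x y x2 : ℚ} (h : y ^ 2 = x ^ 3 + x - (m : ℚ) ^ 6) (hy : y ≠ 0)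
    (hx2 : x2 = ((3 * x ^ 2 + 1) / (2 * y)) ^ 2 - 2 * x) :
    x2 * (4 * y ^ 2) = x ^ 4 - 2 * x ^ 2 + 8 * (m : ℚ) ^ 6 * x + 1 := by
  have h1 : x2 * (4 * y ^ 2) = (3 * x ^ 2 + 1) ^ 2 - 8 * x * y ^ 2 := by
    rw [hx2]; field_simp; ring
  rw [h1, h]; ring

theorem Em'_trip {m : ℤ} (x y : ℚ) (h : (Em' m).toAffine.Nonsingular x y) (hy : y ≠ 0)
    (psi : ℚ) (hpsi : psi = 3 * x ^ 4 + 6 * x ^ 2 - 12 * (m : ℚ) ^ 6 * x - 1) (h0 : psi ≠ 0) :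
    ∃ (x3 y3 : ℚ) (h3 : (Em' m).toAffine.Nonsingular x3 y3),
      3 • Point.some x y h = Point.some x3 y3 h3 ∧
      x3 * psi ^ 2 = x * psi ^ 2 + (4 * (x ^ 3 + x - (m : ℚ) ^ 6)) ^ 3
        - 2 * (4 * (x ^ 3 + x - (m : ℚ) ^ 6)) * (3 * x ^ 2 + 1) * psi := by
  obtain ⟨x2, y2, h2, e2, hx2, hy2⟩ := Em'_dbl h hy
  have e := Em'_eqn h
  have hd := Em'_dbl_x e hy hx2
  have hg : (x2 - x) * (4 * y ^ 2) = - psi := by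
    rw [sub_mul, hd, e, hpsi]; ring
  have hgne : x2 - x ≠ 0 := by
    intro h'
    rw [h'] at hg
    apply h0
    linarith
  have hne : x2 ≠ x := sub_ne_zero.1 hgne
  have h3 : 3 • Point.some x y h = Point.some x2 y2 h2 + Point.some x y h := by
    rw [← e2, succ_nsmul, two_nsmul]
  rw [h3, Point.add_of_X_ne hne]
  refine ⟨_, _, _, rfl, ?_⟩
  rw [slope_of_X_ne hne]
  simp only [addX, Em']
  obtain ⟨l, hl⟩ : ∃ l, l = (3 * x ^ 2 + 1) / (2 * y) := ⟨_, rfl⟩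
  rw [← hl] at hx2 hy2
  have hl' : l * (2 * y) = 3 * x ^ 2 + 1 := by rw [hl]; field_simp
  obtain ⟨g, hgd⟩ : ∃ g, g = x2 - x := ⟨_, rfl⟩
  rw [← hgd] at hg hgne hy2 ⊢
  have hpsi2 : psi = - (g * (4 * y ^ 2)) := by linarith
  have hsl : (y2 - y) / g = -(2 * y / g + l) := by
    rw [hy2]; field_simp; ring
  have key : (-(2 * y / g + l)) ^ 2 + 0 * (-(2 * y / g + l)) - 0 - x2 - x
      = x + 4 * y ^ 2 / g ^ 2 + 2 * (3 * x ^ 2 + 1) / g := by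
    rw [hx2, ← hl']; field_simp; ring
  rw [hsl, key, hpsi2, ← e]
  field_simp
  ring

instance fact_three : Fact (Nat.Prime 3) := ⟨Nat.prime_three⟩

theorem coe_ofNat3 (n : ℕ) [n.AtLeastTwo] :
    ((OfNat.ofNat n : ℤ_[3]) : ℚ_[3]) = OfNat.ofNat n :=
  PadicInt.coe_natCast n

theorem norm_one_add_three (w : ℤ_[3]) : ‖((1 + 3 * w : ℤ_[3]) : ℚ_[3])‖ = 1 := by
  rw [← PadicInt.norm_def]
  have h : ‖(3 * w : ℤ_[3])‖ < 1 := by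
    rw [PadicInt.norm_lt_one_iff_dvd]
    exact ⟨w, by norm_num⟩
  have h1 : ‖(1 : ℤ_[3])‖ = 1 := norm_one
  rw [PadicInt.norm_add_eq_max_of_ne (by rw [h1]; exact h.ne'), h1]
  exact max_eq_left h.le

/-- The 3-adic size of the x-coordinate. -/
noncomputable def xnorm {m : ℤ} : (Em' m).toAffine.Point → ℝ
  | .zero => 0
  | .some x _ _ => ‖(x : ℚ_[3])‖

theorem xnorm_trip {m : ℤ} (hm : m ≠ 0) (p : (Em' m).toAffine.Point) (hp : 1 < xnorm p) :
    xnorm p < xnorm (3 • p) := by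
  rcases p with _ | ⟨x, y, h⟩
  · simp [xnorm] at hp
    linarith
  simp only [xnorm] at hp
  have hy := Em'_y_ne hm (Em'_eqn h)
  obtain ⟨X, hX⟩ : ∃ X : ℚ_[3], X = (x : ℚ_[3]) := ⟨_, rfl⟩
  rw [← hX] at hp
  have hX0 : X ≠ 0 := by
    rintro rfl
    simp at hp
    linarith
  obtain ⟨u, hu⟩ : ∃ u : ℤ_[3], (u : ℚ_[3]) = X⁻¹ := by
    refine ⟨⟨X⁻¹, ?_⟩, rfl⟩
    rw [norm_inv]
    exact inv_le_one_of_one_le₀ hp.le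
  have hu1 : ‖u‖ < 1 := by
    rw [PadicInt.norm_def, hu, norm_inv]
    exact inv_lt_one_of_one_lt₀ hp
  rw [PadicInt.norm_lt_one_iff_dvd] at hu1
  obtain ⟨v, hv⟩ := hu1
  obtain ⟨c, hc⟩ : ∃ c : ℤ_[3], c = (m : ℤ_[3]) ^ 6 := ⟨_, rfl⟩
  have hcQ : (c : ℚ_[3]) = (m : ℚ_[3]) ^ 6 := by rw [hc]; push_cast; rfl
  have hXv : X * (3 * (v : ℚ_[3])) = 1 := by
    have : (u : ℚ_[3]) = 3 * (v : ℚ_[3]) := by rw [hv]; push_cast; rfl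
    rw [← this, hu, mul_inv_cancel₀ hX0]
  obtain ⟨r, hr⟩ : ∃ r : ℤ_[3], r = 6 * v ^ 2 - 36 * c * v ^ 3 - 9 * v ^ 4 := ⟨_, rfl⟩
  obtain ⟨e, he⟩ : ∃ e : ℤ_[3], e = 1 + 12 * v ^ 2 - 36 * c * v ^ 3 := ⟨_, rfl⟩
  obtain ⟨s, hs⟩ : ∃ s : ℤ_[3], s = 3 * (1 + 3 * r) ^ 2 + 3 * e + 9 * e ^ 2 + 9 * e ^ 3
    - 2 * (1 + 3 * e) * (3 + 9 * v ^ 2) * (1 + 3 * r) := ⟨_, rfl⟩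
  obtain ⟨psi, hpsi⟩ : ∃ psi : ℚ, psi = 3 * x ^ 4 + 6 * x ^ 2 - 12 * (m : ℚ) ^ 6 * x - 1 :=
    ⟨_, rfl⟩
  have c2 : ((2 : ℤ_[3]) : ℚ_[3]) = 2 := coe_ofNat3 2
  have c3 : ((3 : ℤ_[3]) : ℚ_[3]) = 3 := coe_ofNat3 3
  have c6 : ((6 : ℤ_[3]) : ℚ_[3]) = 6 := coe_ofNat3 6
  have c9 : ((9 : ℤ_[3]) : ℚ_[3]) = 9 := coe_ofNat3 9
  have c12 : ((12 : ℤ_[3]) : ℚ_[3]) = 12 := coe_ofNat3 12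
  have c36 : ((36 : ℤ_[3]) : ℚ_[3]) = 36 := coe_ofNat3 36
  have hXi : X = (3 * (v : ℚ_[3]))⁻¹ := eq_inv_of_mul_eq_one_left hXv
  have hv0 : (v : ℚ_[3]) ≠ 0 := by
    intro h0
    rw [h0] at hXv
    simp at hXv
  have hpsiQ : (psi : ℚ_[3]) = 3 * X ^ 4 * ((1 + 3 * r : ℤ_[3]) : ℚ_[3]) := by
    rw [hpsi, hr]; push_cast; rw [c3, c6, c9, c36]
    rw [← hX, hcQ, hXi]
    field_simp
    ring
  have hn3 : ‖(3 : ℚ_[3])‖ = 3⁻¹ := by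
    have := Padic.norm_p (p := 3)
    simpa using this
  have hXn : 0 < ‖X‖ := by linarith
  have hpsin : ‖(psi : ℚ_[3])‖ = 3⁻¹ * ‖X‖ ^ 4 := by
    rw [hpsiQ, norm_mul, norm_mul, norm_one_add_three, norm_pow, hn3, mul_one]
  have hpsi0 : psi ≠ 0 := by
    rintro rfl
    have : 0 < 3⁻¹ * ‖X‖ ^ 4 := by positivity
    rw [← hpsin] at this
    simp at this
  obtain ⟨x3, y3, h3, e3, hx3⟩ := Em'_trip x y h hy psi hpsi hpsi0
  have hD : (4 * (X ^ 3 + X - (m : ℚ_[3]) ^ 6)) = X ^ 3 * ((1 + 3 * e : ℤ_[3]) : ℚ_[3]) := by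
    rw [he]; push_cast; rw [c3, c12, c36]
    rw [hcQ, hXi]
    field_simp
    ring
  have hx3Q : (x3 : ℚ_[3]) * (psi : ℚ_[3]) ^ 2 = X ^ 9 * ((1 + 3 * s : ℤ_[3]) : ℚ_[3]) := by
    have h1 := congrArg (Rat.cast : ℚ → ℚ_[3]) hx3
    push_cast at h1
    rw [h1, ← hX, hD, hpsiQ, hs]
    have h32 : 3 * X ^ 2 + 1 = X ^ 2 * (3 + 9 * (v : ℚ_[3]) ^ 2) := by
      linear_combination (-1 - 3 * X * v) * hXv
    rw [h32]
    push_cast; rw [c2, c3, c9]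
    ring
  have hfin : ‖(x3 : ℚ_[3])‖ * (3⁻¹ * ‖X‖ ^ 4) ^ 2 = ‖X‖ ^ 9 := by
    rw [← hpsin, ← norm_pow, ← norm_mul, hx3Q, norm_mul, norm_one_add_three, norm_pow, mul_one]
  have hfin2 : ‖(x3 : ℚ_[3])‖ = 9 * ‖X‖ := by
    have : (0 : ℝ) < ‖X‖ ^ 8 := by positivity
    apply mul_right_cancel₀ this.ne'
    linear_combination 9 * hfin
  rw [e3]
  simp only [xnorm]
  rw [← hX, hfin2]
  linarith

theorem xnorm_not_gt {m : ℤ} (hm : m ≠ 0) (p : (Em' m).toAffine.Point)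
    (hf : IsOfFinAddOrder p) : xnorm p ≤ 1 := by
  by_contra! hp
  have hgt : ∀ n : ℕ, 1 < xnorm (3 ^ n • p) := by
    intro n
    induction n with
    | zero => simpa using hp
    | succ k ih =>
      have := xnorm_trip hm _ ih
      rw [pow_succ', mul_nsmul']
      linarith
  have hmono : StrictMono (fun n : ℕ => xnorm (3 ^ n • p)) := by
    apply strictMono_nat_of_lt_succ
    intro n
    have := xnorm_trip hm _ (hgt n)
    rwa [pow_succ', mul_nsmul']
  have hinj := hmono.injective
  have hfin : (Set.range (fun n : ℕ => xnorm (3 ^ n • p))).Finite := by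
    have h1 : ((AddSubmonoid.multiples p : Set (Em' m).toAffine.Point)).Finite :=
      finite_multiples.2 hf
    refine (h1.image xnorm).subset ?_
    rintro _ ⟨n, rfl⟩
    exact ⟨_, ⟨3 ^ n, rfl⟩, rfl⟩
  exact Set.infinite_range_of_injective hinj hfin

/-- Lifting an affine point with 3-integral x-coordinate to `ℤ_[3]`. -/
theorem lift_int {m : ℤ} {x y : ℚ} (h : y ^ 2 = x ^ 3 + x - (m : ℚ) ^ 6)
    (hx : ‖(x : ℚ_[3])‖ ≤ 1) :
    ∃ X Y : ℤ_[3], (X : ℚ_[3]) = x ∧ (Y : ℚ_[3]) = y ∧ Y ^ 2 = X ^ 3 + X - (m : ℤ_[3]) ^ 6 := by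
  obtain ⟨X, hX⟩ : ∃ X : ℤ_[3], (X : ℚ_[3]) = x := ⟨⟨x, hx⟩, rfl⟩
  have h1 : (y : ℚ_[3]) ^ 2 = ((X ^ 3 + X - (m : ℤ_[3]) ^ 6 : ℤ_[3]) : ℚ_[3]) := by
    have h1 := congrArg (Rat.cast : ℚ → ℚ_[3]) h
    push_cast at h1 ⊢
    rw [h1, hX]
  have h2 : ‖(y : ℚ_[3])‖ ≤ 1 := by
    have : ‖(y : ℚ_[3])‖ ^ 2 ≤ 1 := by
      rw [← norm_pow, h1]
      exact PadicInt.norm_le_one _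
    nlinarith [norm_nonneg (y : ℚ_[3])]
  refine ⟨X, ⟨y, h2⟩, hX, rfl, ?_⟩
  apply PadicInt.ext
  rw [← h1]
  rfl

theorem zmod_step1 : ∀ X Y M : ZMod 3, Y ^ 2 = X ^ 3 + X - M ^ 6 → Y = 0 →
    X ^ 4 - 2 * X ^ 2 + 8 * M ^ 6 * X + 1 ≠ 0 := by decide

theorem zmod_step2 : ∀ X Y M X2 : ZMod 3, Y ^ 2 = X ^ 3 + X - M ^ 6 → Y ≠ 0 →
    X2 * (4 * Y ^ 2) = X ^ 4 - 2 * X ^ 2 + 8 * M ^ 6 * X + 1 →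
    ∀ Y2 : ZMod 3, Y2 ^ 2 = X2 ^ 3 + X2 - M ^ 6 → Y2 = 0 := by decide

/-- The doubling formula over `ℤ_[3]`, when the double is again 3-integral. -/
theorem dbl_int {m : ℤ} {x x2 y : ℚ} {X Y X2 : ℤ_[3]} (hX : (X : ℚ_[3]) = x)
    (hY : (Y : ℚ_[3]) = y) (hX2 : (X2 : ℚ_[3]) = x2)
    (hd : x2 * (4 * y ^ 2) = x ^ 4 - 2 * x ^ 2 + 8 * (m : ℚ) ^ 6 * x + 1) :
    X2 * (4 * Y ^ 2) = X ^ 4 - 2 * X ^ 2 + 8 * (m : ℤ_[3]) ^ 6 * X + 1 := by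
  apply PadicInt.ext
  have h1 := congrArg (Rat.cast : ℚ → ℚ_[3]) hd
  push_cast at h1 ⊢
  rw [hX, hY, hX2]
  exact h1

theorem red_Y_ne {m : ℤ} {x x2 y : ℚ} {X Y X2 : ℤ_[3]} (hX : (X : ℚ_[3]) = x)
    (hY : (Y : ℚ_[3]) = y) (hX2 : (X2 : ℚ_[3]) = x2)
    (hd : x2 * (4 * y ^ 2) = x ^ 4 - 2 * x ^ 2 + 8 * (m : ℚ) ^ 6 * x + 1)
    (hE : Y ^ 2 = X ^ 3 + X - (m : ℤ_[3]) ^ 6) : PadicInt.toZMod Y ≠ 0 := by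
  intro h0
  have h1 := congrArg PadicInt.toZMod (dbl_int hX hY hX2 hd)
  have h2 := congrArg PadicInt.toZMod hE
  simp only [map_mul, map_pow, map_add, map_sub, map_one, map_ofNat] at h1 h2
  apply zmod_step1 _ _ _ h2 h0
  rw [← h1, h0]
  ring

/-- For every nonzero integer `m`, the curve `E'_m : y² = x³ + x - m⁶` has trivial torsion
subgroup: the only rational point of finite order is the identity. -/
theorem Em'_torsion_trivial (m : ℤ) (hm : m ≠ 0) :
    ∀ p : (Em' m).toAffine.Point, IsOfFinAddOrder p → p = 0 := by
  intro p hp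
  rcases p with _ | ⟨x, y, h⟩
  · rfl
  exfalso
  have e := Em'_eqn h
  have hy := Em'_y_ne hm e
  obtain ⟨x2, y2, h2, e2, hx2, -⟩ := Em'_dbl h hy
  have eq2 := Em'_eqn h2
  have hy2 := Em'_y_ne hm eq2
  obtain ⟨x4, y4, h4, e4, hx4, -⟩ := Em'_dbl h2 hy2
  have hd := Em'_dbl_x e hy hx2
  have hd2 := Em'_dbl_x eq2 hy2 hx4
  have hp2 : IsOfFinAddOrder (Point.some x2 y2 h2) := by
    rw [← e2]; exact hp.add hp
  have hp4 : IsOfFinAddOrder (Point.some x4 y4 h4) := by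
    rw [← e4]; exact hp2.add hp2
  have n1 := xnorm_not_gt hm _ hp
  have n2 := xnorm_not_gt hm _ hp2
  have n4 := xnorm_not_gt hm _ hp4
  simp only [xnorm] at n1 n2 n4
  obtain ⟨X, Y, hX, hY, hE⟩ := lift_int e n1
  obtain ⟨X2, Y2, hX2, hY2, hE2⟩ := lift_int eq2 n2
  obtain ⟨X4, hX4⟩ : ∃ X4 : ℤ_[3], (X4 : ℚ_[3]) = x4 := ⟨⟨x4, n4⟩, rfl⟩
  have r1 := red_Y_ne hX hY hX2 hd hE
  have r2 := red_Y_ne hX2 hY2 hX4 hd2 hE2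
  have q1 := congrArg PadicInt.toZMod (dbl_int hX hY hX2 hd)
  have q2 := congrArg PadicInt.toZMod hE
  have q3 := congrArg PadicInt.toZMod hE2
  simp only [map_mul, map_pow, map_add, map_sub, map_one, map_ofNat] at q1 q2 q3
  exact r2 (zmod_step2 _ _ _ _ q2 r1 q1 _ q3)
end
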